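/- Let C ⊆ ℝ^d be convex with constrained least-squares solution x_LS, and consider one step of the iterative Hessian sketch: given the current iterate x^t ∈ ℝ^d with A(x_LS − x^t) ≠ 0 and a sketch matrix S^{t+1} ∈ ℝ^{m×n}, let x^{t+1} minimize (1/(2m))‖S^{t+1} A(x − x^t)‖₂² − ⟨Aᵀ(y − A x^t), x⟩ over x ∈ C. Then Z₁^{t+1} · ‖A(x^{t+1} − x_LS)‖₂ ≤ Z₂^{t+1} · ‖A(x^t − x_LS)‖₂. -/

import Mathlib

open MeasureTheory Matrix Finset

/-- Squared Euclidean norm of a vector. -/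
noncomputable def sqNorm {k : ℕ} (v : Fin k → ℝ) : ℝ := ∑ i, (v i) ^ 2

/-- Euclidean (ℓ₂) norm of a vector. -/
noncomputable def l2norm {k : ℕ} (v : Fin k → ℝ) : ℝ := Real.sqrt (sqNorm v)

/-- Prediction semi-norm ‖v‖_A = (1/√n)‖A v‖₂. -/
noncomputable def predNorm {n d : ℕ} (A : Matrix (Fin n) (Fin d) ℝ) (v : Fin d → ℝ) : ℝ :=
  l2norm (A.mulVec v) / Real.sqrt n

/-- Transformed tangent cone K_LS = {t · A(x − x_LS) : t ≥ 0, x ∈ C}. -/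
def Kcone {n d : ℕ} (A : Matrix (Fin n) (Fin d) ℝ) (C : Set (Fin d → ℝ))
    (xLS : Fin d → ℝ) : Set (Fin n → ℝ) :=
  {v | ∃ t : ℝ, 0 ≤ t ∧ ∃ x ∈ C, v = t • A.mulVec (x - xLS)}

/-- Z₁(S) = inf over unit-norm vectors of the cone of (1/m)‖S v‖₂². -/
noncomputable def Z1 {n m : ℕ} (S : Matrix (Fin m) (Fin n) ℝ) (K : Set (Fin n → ℝ)) : ℝ :=
  sInf ((fun v => (1 / (m : ℝ)) * sqNorm (S.mulVec v)) '' {v ∈ K | l2norm v = 1})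

/-- Z₂(S) = sup over unit-norm vectors of the cone of |⟨u, (SᵀS/m − I) v⟩|. -/
noncomputable def Z2 {n m : ℕ} (S : Matrix (Fin m) (Fin n) ℝ) (K : Set (Fin n → ℝ))
    (u : Fin n → ℝ) : ℝ :=
  sSup ((fun v => |u ⬝ᵥ (((1 / (m : ℝ)) • (Sᵀ * S) - 1).mulVec v)|) '' {v ∈ K | l2norm v = 1})

lemma first_order_aux {a b : ℝ} (h : ∀ s : ℝ, 0 < s → s ≤ 1 → 0 ≤ s * a + s ^ 2 * b) : 0 ≤ a := by
  by_contra ha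
  push Not at ha
  have hb : 0 < |b| + -a := by linarith [abs_nonneg b]
  set s : ℝ := (-a) / (2 * (|b| + -a)) with hs
  have hs0 : 0 < s := by
    apply div_pos <;> linarith
  have hs1 : s ≤ 1 := by
    rw [hs, div_le_one (by linarith)]
    linarith [abs_nonneg b]
  have h1 := h s hs0 hs1
  have h2 : s * (2 * (|b| + -a)) = -a := by
    rw [hs]; field_simp
  have h3 : 0 ≤ a + s * b := by
    by_contra hc
    push Not at hc
    nlinarith
  have h4 : s * b ≤ s * |b| := mul_le_mul_of_nonneg_left (le_abs_self b) hs0.le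
  nlinarith

lemma sqNorm_eq_dot {k : ℕ} (v : Fin k → ℝ) : sqNorm v = v ⬝ᵥ v := by
  simp [sqNorm, dotProduct, pow_two]

lemma sqNorm_nonneg_aux {k : ℕ} (v : Fin k → ℝ) : 0 ≤ sqNorm v :=
  Finset.sum_nonneg fun i _ => sq_nonneg _

lemma l2norm_sq_aux {k : ℕ} (v : Fin k → ℝ) : l2norm v ^ 2 = sqNorm v :=
  Real.sq_sqrt (sqNorm_nonneg_aux v)

lemma sqNorm_smul_aux {k : ℕ} (c : ℝ) (v : Fin k → ℝ) : sqNorm (c • v) = c ^ 2 * sqNorm v := by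
  simp [sqNorm, mul_pow, Finset.mul_sum]

lemma sqNorm_add_smul {k : ℕ} (p q : Fin k → ℝ) (s : ℝ) :
    sqNorm (p + s • q) = sqNorm p + 2 * s * (p ⬝ᵥ q) + s ^ 2 * sqNorm q := by
  simp only [sqNorm_eq_dot, add_dotProduct, dotProduct_add, smul_dotProduct, dotProduct_smul,
    smul_eq_mul, dotProduct_comm q p]
  ring

lemma l2norm_smul_aux {k : ℕ} (c : ℝ) (hc : 0 ≤ c) (v : Fin k → ℝ) :
    l2norm (c • v) = c * l2norm v := by
  rw [l2norm, sqNorm_smul_aux, Real.sqrt_mul (sq_nonneg c), Real.sqrt_sq hc, l2norm]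

lemma l2norm_neg_aux {k : ℕ} (v : Fin k → ℝ) : l2norm (-v) = l2norm v := by
  simp [l2norm, sqNorm]

lemma l2norm_pos_aux {k : ℕ} {v : Fin k → ℝ} (hv : v ≠ 0) : 0 < l2norm v := by
  apply Real.sqrt_pos.2
  rcases (sqNorm_nonneg_aux v).lt_or_eq with h | h
  · exact h
  · exfalso; apply hv
    rw [sqNorm_eq_dot] at h
    exact dotProduct_self_eq_zero.1 h.symm

lemma Z2_bdd {n m : ℕ} (S : Matrix (Fin m) (Fin n) ℝ) (K : Set (Fin n → ℝ)) (u : Fin n → ℝ) :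
    BddAbove ((fun v => |u ⬝ᵥ (((1 / (m : ℝ)) • (Sᵀ * S) - 1).mulVec v)|) ''
      {v ∈ K | l2norm v = 1}) := by
  set Q := (1 / (m : ℝ)) • (Sᵀ * S) - 1 with hQ
  refine ⟨∑ i, |(u ᵥ* Q) i|, ?_⟩
  rintro _ ⟨v, ⟨-, hv⟩, rfl⟩
  show |u ⬝ᵥ (Q *ᵥ v)| ≤ _
  rw [dotProduct_mulVec]
  refine (Finset.abs_sum_le_sum_abs _ _).trans (Finset.sum_le_sum fun i _ => ?_)
  rw [abs_mul]
  have h1 : sqNorm v = 1 := by rw [← l2norm_sq_aux, hv]; norm_num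
  have h2 : (v i) ^ 2 ≤ 1 := by
    rw [← h1]
    exact Finset.single_le_sum (f := fun i => (v i) ^ 2) (fun i _ => sq_nonneg _) (Finset.mem_univ i)
  have h3 : |v i| ≤ 1 := by rwa [← sq_le_one_iff_abs_le_one]
  nlinarith [abs_nonneg ((u ᵥ* Q) i)]

/-- one-step contraction of the iterative Hessian sketch. -/
theorem ihs_one_step_contraction
    {n d m : ℕ} (hn : 0 < n) (hm : 0 < m)
    (C : Set (Fin d → ℝ)) (hC : Convex ℝ C)
    (A : Matrix (Fin n) (Fin d) ℝ) (y : Fin n → ℝ)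
    (St : Matrix (Fin m) (Fin n) ℝ)
    (xLS : Fin d → ℝ) (hLSmem : xLS ∈ C)
    (hLSmin : ∀ x ∈ C,
      (1 / (2 * (n : ℝ))) * sqNorm (A.mulVec xLS - y)
        ≤ (1 / (2 * (n : ℝ))) * sqNorm (A.mulVec x - y))
    (xt : Fin d → ℝ) (hA : A.mulVec (xLS - xt) ≠ 0)
    (xnext : Fin d → ℝ) (hnextmem : xnext ∈ C)
    (hnextmin : ∀ z ∈ C,
      (1 / (2 * (m : ℝ))) * sqNorm (St.mulVec (A.mulVec (xnext - xt)))
          - (Aᵀ.mulVec (y - A.mulVec xt)) ⬝ᵥ xnext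
        ≤ (1 / (2 * (m : ℝ))) * sqNorm (St.mulVec (A.mulVec (z - xt)))
          - (Aᵀ.mulVec (y - A.mulVec xt)) ⬝ᵥ z) :
    Z1 St (Kcone A C xLS) * l2norm (A.mulVec (xnext - xLS)) ≤
      Z2 St (Kcone A C xLS) ((l2norm (A.mulVec (xLS - xt)))⁻¹ • A.mulVec (xLS - xt))
        * l2norm (A.mulVec (xt - xLS)) := by
  set e := A.mulVec (xnext - xLS) with he
  set w := A.mulVec (xLS - xt) with hw
  have hn' : (0 : ℝ) < n := by exact_mod_cast hn
  have hm' : (0 : ℝ) < m := by exact_mod_cast hm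
  have hxt : l2norm (A.mulVec (xt - xLS)) = l2norm w := by
    rw [hw, ← l2norm_neg_aux, ← mulVec_neg, neg_sub]
  rw [hxt]
  have hwpos : 0 < l2norm w := l2norm_pos_aux hA
  have hZ2 : 0 ≤ Z2 St (Kcone A C xLS) ((l2norm w)⁻¹ • w) := by
    apply Real.sSup_nonneg
    rintro _ ⟨v, -, rfl⟩
    exact abs_nonneg _
  by_cases he0 : e = 0
  · have : l2norm e = 0 := by simp [he0, l2norm, sqNorm]
    rw [this, mul_zero]
    positivity
  have hepos : 0 < l2norm e := l2norm_pos_aux he0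
  -- optimality of xLS
  have h1 : 0 ≤ (A.mulVec xLS - y) ⬝ᵥ e := by
    apply first_order_aux (b := sqNorm e / 2)
    intro s hs0 hs1
    have hmem : xLS + s • (xnext - xLS) ∈ C := hC.add_smul_sub_mem hLSmem hnextmem ⟨hs0.le, hs1⟩
    have h := le_of_mul_le_mul_left (hLSmin _ hmem) (by positivity)
    have hr : A.mulVec (xLS + s • (xnext - xLS)) - y = (A.mulVec xLS - y) + s • e := by
      rw [mulVec_add, mulVec_smul]; abel
    rw [hr, sqNorm_add_smul] at h
    linarith
  -- optimality of xnext
  have h2 : 0 ≤ (1 / (m : ℝ)) * ((St.mulVec (w + e)) ⬝ᵥ (St.mulVec (-e)))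
      - (y - A.mulVec xt) ⬝ᵥ (-e) := by
    apply first_order_aux (b := 1 / (2 * (m : ℝ)) * sqNorm (St.mulVec (-e)))
    intro s hs0 hs1
    have hmem : xnext + s • (xLS - xnext) ∈ C := hC.add_smul_sub_mem hnextmem hLSmem ⟨hs0.le, hs1⟩
    have h := hnextmin _ hmem
    have hne : A.mulVec (xLS - xnext) = -e := by rw [he, ← mulVec_neg, neg_sub]
    have hwe : A.mulVec (xnext - xt) = w + e := by
      rw [he, hw, ← mulVec_add]; congr 1; abel
    have hr : A.mulVec (xnext + s • (xLS - xnext) - xt) = (w + e) + s • (-e) := by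
      rw [← hne, ← hwe, ← mulVec_smul, ← mulVec_add]; congr 1; abel
    have hd : ∀ z, (Aᵀ.mulVec (y - A.mulVec xt)) ⬝ᵥ z = (y - A.mulVec xt) ⬝ᵥ (A.mulVec z) := by
      intro z; rw [mulVec_transpose, dotProduct_mulVec]
    rw [hr, hwe, mulVec_add St (w + e), mulVec_smul, sqNorm_add_smul, hd, hd, mulVec_add A,
      mulVec_smul, hne, dotProduct_add, dotProduct_smul, smul_eq_mul] at h
    have hc : 1 / (m : ℝ) = 2 * (1 / (2 * (m : ℝ))) := by field_simp
    rw [hc]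
    linarith
  have hQ : w ⬝ᵥ (((1 / (m : ℝ)) • (Stᵀ * St) - 1).mulVec e)
      = (1 / (m : ℝ)) * ((St.mulVec w) ⬝ᵥ (St.mulVec e)) - w ⬝ᵥ e := by
    rw [sub_mulVec, one_mulVec, dotProduct_sub, smul_mulVec, dotProduct_smul, smul_eq_mul,
      ← mulVec_mulVec, dotProduct_mulVec w, vecMul_transpose]
  have hry : (y - A.mulVec xt) = w - (A.mulVec xLS - y) := by
    rw [hw, mulVec_sub]; abel
  have h3 : (1 / (m : ℝ)) * sqNorm (St.mulVec e)
      ≤ |w ⬝ᵥ (((1 / (m : ℝ)) • (Stᵀ * St) - 1).mulVec e)| := by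
    refine le_trans ?_ (neg_le_abs _)
    rw [hQ, sqNorm_eq_dot]
    rw [hry] at h2
    rw [sub_dotProduct] at h1
    simp only [mulVec_add, mulVec_neg, dotProduct_neg, add_dotProduct, sub_dotProduct] at h2
    linarith
  -- the normalised direction
  set v := (l2norm e)⁻¹ • e with hv
  have hev : e = l2norm e • v := by rw [hv, smul_smul, mul_inv_cancel₀ hepos.ne', one_smul]
  have hvK : v ∈ {v ∈ Kcone A C xLS | l2norm v = 1} := by
    refine ⟨⟨(l2norm e)⁻¹, by positivity, xnext, hnextmem, rfl⟩, ?_⟩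
    rw [hv, l2norm_smul_aux _ (by positivity), inv_mul_cancel₀ hepos.ne']
  have hz1 : Z1 St (Kcone A C xLS) ≤ (1 / (m : ℝ)) * sqNorm (St.mulVec v) := by
    apply csInf_le
    · refine ⟨0, ?_⟩
      rintro _ ⟨z, -, rfl⟩
      have := sqNorm_nonneg_aux (St.mulVec z)
      positivity
    · exact ⟨v, hvK, rfl⟩
  have hz2 : |((l2norm w)⁻¹ • w) ⬝ᵥ (((1 / (m : ℝ)) • (Stᵀ * St) - 1).mulVec v)|
      ≤ Z2 St (Kcone A C xLS) ((l2norm w)⁻¹ • w) :=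
    le_csSup (Z2_bdd _ _ _) ⟨v, hvK, rfl⟩
  have e1 : sqNorm (St.mulVec e) = l2norm e ^ 2 * sqNorm (St.mulVec v) := by
    rw [← sqNorm_smul_aux, ← mulVec_smul, ← hev]
  have e2 : |w ⬝ᵥ (((1 / (m : ℝ)) • (Stᵀ * St) - 1).mulVec e)| = l2norm w * l2norm e *
      |((l2norm w)⁻¹ • w) ⬝ᵥ (((1 / (m : ℝ)) • (Stᵀ * St) - 1).mulVec v)| := by
    rw [hv, mulVec_smul, dotProduct_smul, smul_dotProduct, smul_eq_mul, smul_eq_mul, abs_mul,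
      abs_mul, abs_of_pos (inv_pos.2 hepos), abs_of_pos (inv_pos.2 hwpos)]
    field_simp
  rw [e1, e2] at h3
  have h4 : l2norm e * (Z1 St (Kcone A C xLS) * l2norm e) ≤
      l2norm e * (Z2 St (Kcone A C xLS) ((l2norm w)⁻¹ • w) * l2norm w) := by
    have ha := mul_le_mul_of_nonneg_left hz1 (sq_nonneg (l2norm e))
    have hb := mul_le_mul_of_nonneg_left hz2 (mul_pos hwpos hepos).le
    linarith
  exact le_of_mul_le_mul_left h4 hepos
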